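/- (Theorem 1, m agents.) Let N ≥ 1 and let the base policy π = (μ_0, …, μ_{N−1}) and roll-out policy π̃ = (μ̃_0, …, μ̃_{N−1}) be sequences of stage policies μ_k = (μ_k¹, …, μ_kᵐ), μ̃_k = (μ̃_k¹, …, μ̃_kᵐ). Define their exact cost-to-go functions backward by J_{N,π} = J_{N,π̃} = g_N and, for k = N−1, …, 0, J_{k,π}(x) = ∑_{y∈S} p x (μ_k¹ x, …, μ_kᵐ x) y · (g x (μ_k¹ x, …, μ_kᵐ x) y + J_{k+1,π}(y)) and analogously for π̃. Let β ≥ 0 and for each k ∈ {0,…,N−1} let J^ALP_{k+1,π} : S → ℝ satisfy J^ALP_{k+1,π}(y) ≤ J_{k+1,π}(y) and |J_{k+1,π}(y) − J^ALP_{k+1,π}(y)| ≤ β for all y ∈ S. Suppose for every k ∈ {0,…,N−1}, every agent i ∈ {1,…,m}, and every x ∈ S, μ̃_kⁱ(x) minimizes uⁱ ↦ ∑_{y∈S} p x (μ̃_k¹ x, …, μ̃_k^{i−1} x, uⁱ, μ_k^{i+1} x, …, μ_kᵐ x) y · (g x (μ̃_k¹ x, …, uⁱ, …, μ_kᵐ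 x) y + J^ALP_{k+1,π}(y)) over uⁱ ∈ Uⁱ. Then for every k ∈ {0,…,N} and every x ∈ S, J_{k,π̃}(x) ≤ J_{k,π}(x) + (N−k)·β. -/

import Mathlib

/-- Joint action in which agents j < i use the updated policy μt, agent i uses action u,
and agents j > i use the base policy μ. -/
def mixAction {m : ℕ} {S : Type*} {U : Fin m → Type*}
    (μt μ : ∀ i, S → U i) (i : Fin m) (u : U i) (x : S) : ∀ j, U j :=
  fun j => if h : j = i then cast (congrArg U h.symm) u
           else if j < i then μt j x else μ j x

/-- Joint action in which the first `c` agents use the updated policy and the others the base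
policy. -/
def prefixAction {m : ℕ} {S : Type*} {U : Fin m → Type*}
    (μt μ : ∀ i, S → U i) (c : ℕ) (x : S) : ∀ j, U j :=
  fun j => if j.val < c then μt j x else μ j x

theorem mixAction_updated {m : ℕ} {S : Type*} {U : Fin m → Type*}
    (μt μ : ∀ i, S → U i) (i : Fin m) (x : S) :
    mixAction μt μ i (μt i x) x = prefixAction μt μ (i.val + 1) x := by
  funext j
  unfold mixAction prefixAction
  by_cases h : j = i
  · subst h
    simp
  · have h_iff : j < i ↔ j.val < i.val + 1 := by
      rw [Fin.lt_def]
      have := Fin.val_ne_of_ne h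
      omega
    simp only [h, dif_neg, not_false_eq_true, h_iff]

theorem mixAction_base {m : ℕ} {S : Type*} {U : Fin m → Type*}
    (μt μ : ∀ i, S → U i) (i : Fin m) (x : S) :
    mixAction μt μ i (μ i x) x = prefixAction μt μ i.val x := by
  funext j
  unfold mixAction prefixAction
  by_cases h : j = i
  · subst h
    simp
  · simp only [h, dif_neg, not_false_eq_true, Fin.lt_def]

/-- Agent-by-agent minimization does not increase the objective. -/
theorem le_of_agent_by_agent_min {m : ℕ} {S : Type*} {U : Fin m → Type*}
    (μt μ : ∀ i, S → U i) (x : S) (Q : (∀ i, U i) → ℝ)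
    (hQ : ∀ (i : Fin m) (u : U i),
      Q (mixAction μt μ i (μt i x) x) ≤ Q (mixAction μt μ i u x)) :
    Q (fun i => μt i x) ≤ Q (fun i => μ i x) := by
  have h_chain : ∀ c ≤ m, Q (prefixAction μt μ c x) ≤ Q (fun i => μ i x) := by
    intro c
    induction c with
    | zero => intro _; exact (congrArg Q (funext fun j => by simp [prefixAction])).le
    | succ c ih =>
      intro hc
      have h := hQ ⟨c, hc⟩ (μ ⟨c, hc⟩ x)
      rw [mixAction_updated, mixAction_base] at h
      exact h.trans (ih (by omega))
  have h_full : prefixAction μt μ m x = fun i => μt i x :=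
    funext fun j => by simp [prefixAction]
  exact h_full ▸ h_chain m le_rfl

/-- Theorem 1, m agents: for every k ∈ {0,…,N} and every x ∈ S,
J_{k,π̃}(x) ≤ J_{k,π}(x) + (N−k)·β. -/
theorem theorem1_m_agents {S : Type*} [Fintype S] [Nonempty S]
    {m : ℕ} (hm : 1 ≤ m) (U : Fin m → Type*)
    [∀ i, Fintype (U i)] [∀ i, Nonempty (U i)]
    (p g : S → (∀ i, U i) → S → ℝ)
    (hp0 : ∀ x u y, 0 ≤ p x u y)
    (hp1 : ∀ x u, ∑ y, p x u y = 1)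
    (N : ℕ) (hN : 1 ≤ N)
    (μ μt : ℕ → ∀ i, S → U i)
    (gN : S → ℝ)
    (Jπ Jπt : ℕ → S → ℝ)
    (hJπN : ∀ x : S, Jπ N x = gN x)
    (hJπtN : ∀ x : S, Jπt N x = gN x)
    (hJπ : ∀ k < N, ∀ x : S,
      Jπ k x = ∑ y, p x (fun i => μ k i x) y * (g x (fun i => μ k i x) y + Jπ (k+1) y))
    (hJπt : ∀ k < N, ∀ x : S,
      Jπt k x = ∑ y, p x (fun i => μt k i x) y *
        (g x (fun i => μt k i x) y + Jπt (k+1) y))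
    (β : ℝ) (hβ : 0 ≤ β)
    (JALP : ℕ → S → ℝ)
    (hALPle : ∀ k < N, ∀ y : S, JALP (k+1) y ≤ Jπ (k+1) y)
    (hALPerr : ∀ k < N, ∀ y : S, |Jπ (k+1) y - JALP (k+1) y| ≤ β)
    (hmin : ∀ k < N, ∀ (i : Fin m) (x : S) (u : U i),
      (∑ y, p x (mixAction (μt k) (μ k) i (μt k i x) x) y *
          (g x (mixAction (μt k) (μ k) i (μt k i x) x) y + JALP (k+1) y))
        ≤ ∑ y, p x (mixAction (μt k) (μ k) i u x) y *
            (g x (mixAction (μt k) (μ k) i u x) y + JALP (k+1) y)) :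
    ∀ k ≤ N, ∀ x : S, Jπt k x ≤ Jπ k x + ((N - k : ℕ) : ℝ) * β := by
  intro k hk
  induction hk using Nat.decreasingInduction with
  | self => intro x; simp [hJπN, hJπtN]
  | of_succ k hk ih =>
    intro x
    have h_min := le_of_agent_by_agent_min (μt k) (μ k) x
      (fun u => ∑ y, p x u y * (g x u y + JALP (k+1) y)) (fun i u => hmin k hk i x u)
    have h_base : ∑ y, p x (fun i => μ k i x) y * (g x (fun i => μ k i x) y + JALP (k+1) y)
        ≤ Jπ k x := by
      rw [hJπ k hk x]
      gcongr with y
      · exact hp0 _ _ _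
      · exact hALPle k hk y
    have h_sub : ((N - k : ℕ) : ℝ) = ((N - (k+1) : ℕ) : ℝ) + 1 := by
      rw [← Nat.cast_succ]
      congr 1
      omega
    calc Jπt k x
        = ∑ y, p x (fun i => μt k i x) y * (g x (fun i => μt k i x) y + Jπt (k+1) y) :=
          hJπt k hk x
      _ ≤ ∑ y, p x (fun i => μt k i x) y *
            (g x (fun i => μt k i x) y + (JALP (k+1) y + ((N - k : ℕ) : ℝ) * β)) := by
          gcongr with y
          · exact hp0 _ _ _
          · have h_err := (abs_le.mp (hALPerr k hk y)).2
            have h_ih := ih y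
            rw [h_sub]
            linarith
      _ = ∑ y, p x (fun i => μt k i x) y * (g x (fun i => μt k i x) y + JALP (k+1) y)
            + ((N - k : ℕ) : ℝ) * β := by
          simp_rw [← add_assoc, mul_add _ (_ + _) (_ * β)]
          rw [Finset.sum_add_distrib, ← Finset.sum_mul, hp1, one_mul]
      _ ≤ Jπ k x + ((N - k : ℕ) : ℝ) * β := by
          gcongr
          exact h_min.trans h_base
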